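/- Suppose f(x,·) is concave for every x ∈ X. Then the proximal error bound ‖x(z^{t+1},v₊^t(z^{t+1})) − x(z^{t+1},v(z^{t+1}))‖² ≤ ω₁·‖v₊^t(z^{t+1}) − v^t‖ holds, where ω₁ = (4r₂·diam(Y)/(r₁−L_x))·((1−μ)/μ + r₂/(r₂−L_y)). -/

import Mathlib

open scoped RealInnerProductSpace

/-- First-order optimality for a proximal problem. -/
lemma prox_opt {G : Type*} [NormedAddCommGroup G] [InnerProductSpace ℝ G]
    {S : Set G} {φ : G → ℝ} (hφ : ConvexOn ℝ S φ) {c : ℝ} {a x0 : G} (hx0 : x0 ∈ S)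
    (hmin : ∀ x ∈ S, φ x0 + c / 2 * ‖x0 - a‖ ^ 2 ≤ φ x + c / 2 * ‖x - a‖ ^ 2)
    {x : G} (hx : x ∈ S) : φ x0 - c * ⟪x0 - a, x - x0⟫ ≤ φ x := by
  have key : ∀ t : ℝ, 0 < t → t ≤ 1 →
      0 ≤ φ x - φ x0 + c * ⟪x0 - a, x - x0⟫ + t * (c / 2 * ‖x - x0‖ ^ 2) := by
    intro t ht ht1
    have hmem := hφ.1 hx0 hx (sub_nonneg.2 ht1) ht.le (by ring)
    have h1 := hφ.2 hx0 hx (sub_nonneg.2 ht1) ht.le (by ring)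
    have h2 := hmin _ hmem
    have h3 : (1 - t) • x0 + t • x - a = (x0 - a) + t • (x - x0) := by
      module
    rw [h3, norm_add_sq_real, inner_smul_right, norm_smul, mul_pow, Real.norm_eq_abs, sq_abs] at h2
    simp only [smul_eq_mul] at h1
    have h4 : 0 ≤ t * (φ x - φ x0 + c * ⟪x0 - a, x - x0⟫ + t * (c / 2 * ‖x - x0‖ ^ 2)) := by
      nlinarith
    exact nonneg_of_mul_nonneg_right h4 ht
  have hlim : Filter.Tendsto (fun t : ℝ => φ x - φ x0 + c * ⟪x0 - a, x - x0⟫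
      + t * (c / 2 * ‖x - x0‖ ^ 2)) (nhdsWithin 0 (Set.Ioi 0))
      (nhds (φ x - φ x0 + c * ⟪x0 - a, x - x0⟫ + 0 * (c / 2 * ‖x - x0‖ ^ 2))) := by
    apply Filter.Tendsto.mono_left _ nhdsWithin_le_nhds
    apply Continuous.tendsto
    fun_prop
  have := ge_of_tendsto hlim (by
    filter_upwards [Ioc_mem_nhdsGT (zero_lt_one' ℝ)] with t ht
    exact key t ht.1 ht.2)
  linarith

/-- A function with `L`-Lipschitz gradient becomes convex after adding a quadratic. -/
lemma weak_convex {G : Type*} [NormedAddCommGroup G] [InnerProductSpace ℝ G] [CompleteSpace G]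
    {φ : G → ℝ} {g : G → G} {L : ℝ} (z : G) (hg : ∀ x, HasGradientAt φ (g x) x)
    (hL : ∀ x x', ‖g x - g x'‖ ≤ L * ‖x - x'‖) :
    ConvexOn ℝ Set.univ (fun x => φ x + L / 2 * ‖x - z‖ ^ 2) := by
  refine ⟨convex_univ, fun x _ y _ a b ha hb hab => ?_⟩
  set w := y - x with hw
  have hder : ∀ s : ℝ, HasDerivAt
      (fun s : ℝ => φ (x + s • w) + L / 2 * ‖(x + s • w) - z‖ ^ 2)
      (⟪g (x + s • w), w⟫ + L * ⟪x + s • w - z, w⟫) s := by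
    intro s
    have hl : HasDerivAt (fun s : ℝ => x + s • w) w s := by
      simpa using ((hasDerivAt_id s).smul_const w).const_add x
    have h1 := (hg (x + s • w)).hasFDerivAt.comp_hasDerivAt s hl
    have h2 := (hl.sub_const z).norm_sq
    have h3 := h1.add (h2.const_mul (L / 2))
    have e : ⟪g (x + s • w), w⟫ + L * ⟪x + s • w - z, w⟫ =
        ((InnerProductSpace.toDual ℝ G) (g (x + s • w))) w
          + L / 2 * (2 * ⟪x + s • w - z, w⟫) := by
      rw [InnerProductSpace.toDual_apply_apply]
      ring
    rw [e]
    exact h3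
  have hmono : Monotone (deriv (fun s : ℝ => φ (x + s • w) + L / 2 * ‖(x + s • w) - z‖ ^ 2)) := by
    intro s t hst
    rw [(hder s).deriv, (hder t).deriv]
    rcases hst.eq_or_lt with h | h
    · rw [h]
    have e1 : (x + t • w) - (x + s • w) = (t - s) • w := by module
    have h1 := hL (x + t • w) (x + s • w)
    rw [e1, norm_smul, Real.norm_eq_abs, abs_of_pos (sub_pos.2 h)] at h1
    have h2 := neg_le_of_abs_le (abs_real_inner_le_norm (g (x + t • w) - g (x + s • w)) w)
    have h3 : ⟪x + t • w - z, w⟫ - ⟪x + s • w - z, w⟫ = (t - s) * ‖w‖ ^ 2 := by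
      rw [← inner_sub_left]
      have : x + t • w - z - (x + s • w - z) = (t - s) • w := by module
      rw [this, real_inner_smul_left, real_inner_self_eq_norm_sq]
    rw [inner_sub_left] at h2
    have h4 := mul_le_mul_of_nonneg_right h1 (norm_nonneg w)
    have h5 : L * ⟪x + t • w - z, w⟫ - L * ⟪x + s • w - z, w⟫ = L * ((t - s) * ‖w‖ ^ 2) := by
      rw [← h3]; ring
    nlinarith
  have hc := Monotone.convexOn_univ_of_deriv (fun s => (hder s).differentiableAt) hmono
  have := hc.2 (Set.mem_univ 0) (Set.mem_univ 1) ha hb hab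
  have e : a • x + b • y = x + b • w := by
    rw [hw, show a = 1 - b by linarith]; module
  have e2 : x + (1 : ℝ) • w = y := by rw [hw]; module
  simp only [smul_eq_mul, mul_zero, mul_one, zero_add, zero_smul, add_zero, e2] at this
  simp only [e, smul_eq_mul]
  exact this

/-- Expansion of the squared distance. -/
lemma sq_expand {G : Type*} [NormedAddCommGroup G] [InnerProductSpace ℝ G] (x x0 a : G) :
    ‖x - a‖ ^ 2 = ‖x0 - a‖ ^ 2 + 2 * ⟪x0 - a, x - x0⟫ + ‖x - x0‖ ^ 2 := by
  rw [← norm_add_sq_real]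
  congr 2
  abel

/-- Proximal error bound under concavity of the dual function:
if `f(x,·)` is concave for every `x ∈ X`, then with
`v₊^t(z^{t+1}) = v^t + μ(y(z^{t+1},v^t) − v^t)` one has
`‖x(z^{t+1},v₊^t(z^{t+1})) − x(z^{t+1},v(z^{t+1}))‖² ≤ ω₁‖v₊^t(z^{t+1}) − v^t‖`
with `ω₁ = (4r₂ diam(Y)/(r₁−L_x))((1−μ)/μ + r₂/(r₂−L_y))`. -/
theorem stmt_12
    {E D : Type*} [NormedAddCommGroup E] [InnerProductSpace ℝ E] [CompleteSpace E]
    [NormedAddCommGroup D] [InnerProductSpace ℝ D] [CompleteSpace D]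
    (f : E → D → ℝ) (gx : E → D → E) (gy : E → D → D) (Lx Ly r₁ r₂ μ : ℝ)
    (hr₁ : r₁ > Lx) (hr₂ : r₂ > Ly) (hμ : 0 < μ) (hμ1 : μ < 1)
    (X : Set E) (Y : Set D)
    (hXc : IsCompact X) (hXconv : Convex ℝ X) (hXne : X.Nonempty)
    (hYc : IsCompact Y) (hYconv : Convex ℝ Y) (hYne : Y.Nonempty)
    (hgradx : ∀ x y, HasGradientAt (fun x' => f x' y) (gx x y) x)
    (hgrady : ∀ x y, HasGradientAt (fun y' => f x y') (gy x y) y)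
    (hLipx : ∀ x x' y y', ‖gx x y - gx x' y'‖ ≤ Lx * (‖x - x'‖ + ‖y - y'‖))
    (hLipy : ∀ x x' y y', ‖gy x y - gy x' y'‖ ≤ Ly * (‖x - x'‖ + ‖y - y'‖))
    -- concavity of the dual function:
    (hconc : ∀ x ∈ X, ConcaveOn ℝ Set.univ (fun y => f x y))
    (F : E → D → E → D → ℝ)
    (hF : ∀ x y z v, F x y z v
      = f x y + r₁ / 2 * ‖x - z‖ ^ 2 - r₂ / 2 * ‖y - v‖ ^ 2)
    -- h(x,z,v) = max_{y∈Y} F(x,y,z,v)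
    (h : E → E → D → ℝ) (yOf : E → E → D → D)
    (hyOf : ∀ x z v, yOf x z v ∈ Y ∧ IsMaxOn (fun y => F x y z v) Y (yOf x z v) ∧
      h x z v = F x (yOf x z v) z v)
    -- x(z,v) = argmin_{x∈X} max_{y∈Y} F(x,y,z,v)
    (p : E → D → ℝ) (xm : E → D → E)
    (hxm : ∀ z v, xm z v ∈ X ∧ IsMinOn (fun x => h x z v) X (xm z v) ∧
      p z v = h (xm z v) z v)
    -- v(z) = argmax_v p(z,v)
    (vstar : E → D)
    (hvstar : ∀ z, IsMaxOn (fun v => p z v) Set.univ (vstar z))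
    -- d(y,z,v) = min_{x∈X} F(x,y,z,v) and y(z,v) = argmax_{y∈Y} d(y,z,v)
    (d : D → E → D → ℝ) (xOf : D → E → D → E)
    (hxOf : ∀ y z v, xOf y z v ∈ X ∧ IsMinOn (fun x => F x y z v) X (xOf y z v) ∧
      d y z v = F (xOf y z v) y z v)
    (yzv : E → D → D)
    (hyzv : ∀ z v, yzv z v ∈ Y ∧ IsMaxOn (fun y => d y z v) Y (yzv z v)) :
    ∀ (zt1 : E) (vt : D), ‖vt‖ ≤ Metric.diam Y →
      ‖xm zt1 (vt + μ • (yzv zt1 vt - vt)) - xm zt1 (vstar zt1)‖ ^ 2 ≤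
        (4 * r₂ * Metric.diam Y / (r₁ - Lx)) * ((1 - μ) / μ + r₂ / (r₂ - Ly)) *
          ‖(vt + μ • (yzv zt1 vt - vt)) - vt‖ := by
  intro z vt _
  -- degenerate case
  by_cases hdeg : Subsingleton E ∧ Subsingleton D
  · obtain ⟨hE, hD⟩ := hdeg
    have e1 : xm z (vt + μ • (yzv z vt - vt)) - xm z (vstar z) = 0 := Subsingleton.elim _ _
    have e2 : (vt + μ • (yzv z vt - vt)) - vt = 0 := Subsingleton.elim _ _
    rw [e1, e2]; simp
  have hLy : 0 ≤ Ly := by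
    rw [not_and_or, not_subsingleton_iff_nontrivial, not_subsingleton_iff_nontrivial] at hdeg
    rcases hdeg with hN | hN
    · obtain ⟨a, b, hab⟩ := exists_pair_ne E
      have h1 := (norm_nonneg _).trans (hLipy a b 0 0)
      have h2 : 0 < ‖a - b‖ + ‖(0 : D) - 0‖ := by
        simpa using norm_pos_iff.2 (sub_ne_zero.2 hab)
      exact nonneg_of_mul_nonneg_left h1 h2
    · obtain ⟨a, b, hab⟩ := exists_pair_ne D
      have h1 := (norm_nonneg _).trans (hLipy 0 0 a b)
      have h2 : 0 < ‖(0 : E) - 0‖ + ‖a - b‖ := by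
        simpa using norm_pos_iff.2 (sub_ne_zero.2 hab)
      exact nonneg_of_mul_nonneg_left h1 h2
  have hr2 : 0 < r₂ := lt_of_le_of_lt hLy hr₂
  have hm : 0 < r₁ - Lx := sub_pos.2 hr₁
  have hwc : ∀ y, ConvexOn ℝ X (fun x => f x y + Lx / 2 * ‖x - z‖ ^ 2) := by
    intro y
    refine (weak_convex (g := fun x => gx x y) z (fun x => hgradx x y) ?_).subset
      (Set.subset_univ _) hXconv
    intro x x'
    simpa using hLipx x x' y y
  have hsqE : ConvexOn ℝ X (fun x : E => ‖x - z‖ ^ 2) := by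
    have h1 : ConvexOn ℝ Set.univ (fun x : E => ‖x - z‖) := by
      simpa [dist_eq_norm] using convexOn_univ_dist z
    exact (h1.pow (fun _ _ => norm_nonneg _) 2).subset (Set.subset_univ _) hXconv
  have hsqD : ∀ v, ConvexOn ℝ Y (fun y : D => ‖y - v‖ ^ 2) := by
    intro v
    have h1 : ConvexOn ℝ Set.univ (fun x : D => ‖x - v‖) := by
      simpa [dist_eq_norm] using convexOn_univ_dist v
    exact (h1.pow (fun _ _ => norm_nonneg _) 2).subset (Set.subset_univ _) hYconv
  have hconcY : ∀ x ∈ X, ConcaveOn ℝ Y (fun y => f x y) := fun x hx =>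
    (hconc x hx).subset (Set.subset_univ _) hYconv
  -- upper bound by `h`
  have hub : ∀ x v y, y ∈ Y → F x y z v ≤ h x z v := by
    intro x v y hy
    rw [(hyOf x z v).2.2]
    exact (hyOf x z v).2.1 hy
  -- saddle point
  have hsad : ∀ v, ∀ x ∈ X, h (xm z v) z v ≤ F x (yzv z v) z v := by
    intro v x hx
    obtain ⟨a, ha, b, hb, hab⟩ := Sion.exists_isSaddlePointOn (X := X) (Y := Y)
      (f := fun x y => F x y z v) hXne hXconv hXc
      (by
        intro y hy
        apply ContinuousOn.lowerSemicontinuousOn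
        apply Continuous.continuousOn
        have : Continuous (fun x => f x y) :=
          continuous_iff_continuousAt.2 fun x => (hgradx x y).hasFDerivAt.continuousAt
        simp only [hF]
        fun_prop)
      (by
        intro y hy
        apply ConvexOn.quasiconvexOn
        have := ((hwc y).add (hsqE.smul (show 0 ≤ (r₁ - Lx) / 2 by linarith))).add_const
          (- (r₂ / 2 * ‖y - v‖ ^ 2))
        refine this.congr ?_
        intro x _
        simp only [Pi.add_apply, smul_eq_mul, hF]
        ring)
      hYconv hYne hYc
      (by
        intro x hx
        apply ContinuousOn.upperSemicontinuousOn
        apply Continuous.continuousOn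
        have : Continuous (fun y => f x y) :=
          continuous_iff_continuousAt.2 fun y => (hgrady x y).hasFDerivAt.continuousAt
        simp only [hF]
        fun_prop)
      (by
        intro x hx
        apply ConcaveOn.quasiconcaveOn
        have := ((hconcY x hx).sub ((hsqD v).smul (show 0 ≤ r₂ / 2 by linarith))).add_const
          (r₁ / 2 * ‖x - z‖ ^ 2)
        refine this.congr ?_
        intro y _
        simp only [Pi.add_apply, Pi.sub_apply, smul_eq_mul, hF]
        ring)
    have h1 : h (xm z v) z v ≤ h a z v := (hxm z v).2.1 ha
    have h2 : h a z v ≤ d b z v := by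
      rw [(hyOf a z v).2.2, (hxOf b z v).2.2]
      exact hab _ (hxOf b z v).1 _ (hyOf a z v).1
    have h3 : d b z v ≤ d (yzv z v) z v := (hyzv z v).2 hb
    have h4 : d (yzv z v) z v ≤ F x (yzv z v) z v := by
      rw [(hxOf (yzv z v) z v).2.2]
      exact (hxOf (yzv z v) z v).2.1 hx
    linarith
  have hval : ∀ v, h (xm z v) z v = F (xm z v) (yzv z v) z v := fun v =>
    le_antisymm (hsad v _ (hxm z v).1) (hub _ _ _ (hyzv z v).1)
  -- growth in x
  have hgrow : ∀ v, ∀ x ∈ X,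
      h (xm z v) z v + (r₁ - Lx) / 2 * ‖x - xm z v‖ ^ 2 ≤ h x z v := by
    intro v x hx
    have h1 := prox_opt (hwc (yzv z v)) (c := r₁ - Lx) (a := z) (hxm z v).1 (by
      intro x' hx'
      have := hsad v x' hx'
      rw [hval] at this
      simp only [hF] at this
      linarith) hx
    have h2 := hub x v _ (hyzv z v).1
    have h3 := sq_expand x (xm z v) z
    rw [hval]
    rw [hF] at h2 ⊢
    rw [h3] at h1 h2
    linarith
  -- optimality in y
  have hopt : ∀ v, ∀ y ∈ Y, f (xm z v) y ≤
      f (xm z v) (yzv z v) + r₂ * ⟪yzv z v - v, y - yzv z v⟫ := by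
    intro v y hy
    have h1 := prox_opt (φ := fun y => - f (xm z v) y) (hconcY _ (hxm z v).1).neg (c := r₂)
      (a := v) (hyzv z v).1 (by
      intro y' hy'
      have := hub (xm z v) v y' hy'
      rw [hval] at this
      simp only [hF] at this
      linarith) hy
    linarith
  -- concavity of h in v
  have hconcv : ∀ v v', h (xm z v) z v' ≤ h (xm z v) z v + r₂ * ⟪yzv z v - v, v' - v⟫ := by
    intro v v'
    have h1 := hopt v _ (hyOf (xm z v) z v').1
    rw [hval, (hyOf (xm z v) z v').2.2, hF, hF]
    set y1 := yOf (xm z v) z v'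
    have e : y1 - yzv z v = (y1 - v') - (yzv z v - v) + (v' - v) := by abel
    rw [e, inner_add_right, inner_sub_right, real_inner_self_eq_norm_sq] at h1
    have h2 : 0 ≤ ‖(y1 - v') - (yzv z v - v)‖ ^ 2 := by positivity
    rw [norm_sub_sq_real, real_inner_comm] at h2
    have h3 := mul_nonneg hr2.le h2
    linarith
  -- nonexpansiveness of y(z, ·)
  have hnonexp : ∀ v v', ‖yzv z v - yzv z v'‖ ≤ ‖v - v'‖ := by
    intro v v'
    have h1 := hopt v _ (hyzv z v').1
    have h2 := hopt v' _ (hyzv z v).1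
    have h3 := hsad v _ (hxm z v').1
    have h4 := hsad v' _ (hxm z v).1
    rw [hval] at h3 h4
    simp only [hF] at h3 h4
    have e1 : ⟪yzv z v - v, yzv z v' - yzv z v⟫ + ⟪yzv z v' - v', yzv z v - yzv z v'⟫
        = ⟪v - v', yzv z v - yzv z v'⟫ - ‖yzv z v - yzv z v'‖ ^ 2 := by
      rw [← real_inner_self_eq_norm_sq, ← inner_sub_left,
        show yzv z v' - yzv z v = - (yzv z v - yzv z v') by abel, inner_neg_right,
        ← inner_neg_left, ← inner_add_left]
      congr 1
      abel
    have h5 : 0 ≤ r₂ * (⟪v - v', yzv z v - yzv z v'⟫ - ‖yzv z v - yzv z v'‖ ^ 2) := by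
      rw [← e1]; linarith
    have h6 := nonneg_of_mul_nonneg_right h5 hr2
    have h7 := real_inner_le_norm (v - v') (yzv z v - yzv z v')
    by_contra hcon
    push Not at hcon
    have h8 : 0 < ‖yzv z v - yzv z v'‖ := lt_of_le_of_lt (norm_nonneg _) hcon
    nlinarith
  -- the fixed point property of vstar
  have hfix : yzv z (vstar z) = vstar z := by
    set w := vstar z with hw
    have h1 : p z (yzv z w) ≤ p z w := hvstar z (Set.mem_univ _)
    rw [(hxm z _).2.2, (hxm z _).2.2] at h1
    have h2 := hub (xm z (yzv z w)) (yzv z w) _ (hyzv z w).1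
    have h3 := hsad w _ (hxm z (yzv z w)).1
    rw [hF] at h2 h3
    rw [sub_self, norm_zero] at h2
    have h4 : r₂ / 2 * ‖yzv z w - w‖ ^ 2 ≤ 0 := by linarith
    have h5 : ‖yzv z w - w‖ ^ 2 ≤ 0 := by
      by_contra hcon
      push Not at hcon
      have : 0 < r₂ / 2 * ‖yzv z w - w‖ ^ 2 := by positivity
      linarith
    have h6 : ‖yzv z w - w‖ = 0 := by
      have := norm_nonneg (yzv z w - w)
      nlinarith
    exact sub_eq_zero.1 (norm_eq_zero.1 h6)
  set w := vstar z with hw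
  set y := yzv z vt with hy
  set v := vt + μ • (y - vt) with hv
  set δ := Metric.diam Y with hδ
  have hdiam : ∀ a ∈ Y, ∀ b ∈ Y, ‖a - b‖ ≤ δ := by
    intro a ha b hb
    rw [← dist_eq_norm]
    exact Metric.dist_le_diam_of_mem hYc.isBounded ha hb
  have hδ0 : 0 ≤ δ := Metric.diam_nonneg
  have hwY : w ∈ Y := by rw [← hfix]; exact (hyzv z w).1
  have hg1 := hgrow w (xm z v) (hxm z v).1
  have hg2 := hgrow v (xm z w) (hxm z w).1
  rw [norm_sub_rev] at hg2
  set A := ‖xm z v - xm z w‖ ^ 2 with hA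
  -- distance estimates
  have ha0 : 0 < (1 - μ) / μ := div_pos (by linarith) hμ
  have hs1 : ‖y - v‖ = (1 - μ) / μ * ‖v - vt‖ := by
    have e1 : y - v = ((1 - μ) / μ) • (v - vt) := by
      rw [hv, add_sub_cancel_left, smul_smul, div_mul_cancel₀ _ hμ.ne']
      module
    rw [e1, norm_smul, Real.norm_eq_abs, abs_of_pos ha0]
  have hκ : 1 ≤ r₂ / (r₂ - Ly) := by
    rw [le_div_iff₀ (by linarith)]; linarith
  set α := (1 - μ) / μ
  set κ := r₂ / (r₂ - Ly)
  set s := ‖v - vt‖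
  have hs0 : 0 ≤ s := norm_nonneg _
  have hwv : ‖w - v‖ ≤ δ + α * s := by
    have h1 := norm_sub_le_norm_sub_add_norm_sub w y v
    have h2 := hdiam w hwY y (hyzv z vt).1
    linarith
  have hyv : ‖yzv z v - v‖ ≤ (α + κ) * s := by
    have h1 := norm_sub_le_norm_sub_add_norm_sub (yzv z v) y v
    have h2 := hnonexp v vt
    have h3 : s ≤ κ * s := le_mul_of_one_le_left hs0 hκ
    rw [hs1] at h1
    have h4 : ‖yzv z v - y‖ ≤ s := h2
    linarith
  -- first bound
  have hB1 : (r₁ - Lx) * A ≤ r₂ * (δ * (δ + α * s)) := by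
    have e1 := (hyOf (xm z v) z w).2.2
    have e2 := (hyOf (xm z w) z v).2.2
    have m1 := (hyOf (xm z v) z w).1
    have m2 := (hyOf (xm z w) z v).1
    set y1 := yOf (xm z v) z w
    set y2 := yOf (xm z w) z v
    have h1 := hub (xm z v) v y1 m1
    have h2 := hub (xm z w) w y2 m2
    rw [hF] at e1 e2 h1 h2
    have h3 := sq_expand y1 v w
    have h4 := sq_expand y2 v w
    have e3 : ‖y1 - w‖ ^ 2 = ‖y1 - v‖ ^ 2 + 2 * ⟪y1 - v, v - w⟫ + ‖v - w‖ ^ 2 := by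
      rw [← norm_add_sq_real]; congr 2; abel
    have e4 : ‖y2 - w‖ ^ 2 = ‖y2 - v‖ ^ 2 + 2 * ⟪y2 - v, v - w⟫ + ‖v - w‖ ^ 2 := by
      rw [← norm_add_sq_real]; congr 2; abel
    have e5 : ⟪y2 - v, v - w⟫ - ⟪y1 - v, v - w⟫ = ⟪y2 - y1, v - w⟫ := by
      rw [← inner_sub_left]; congr 1; abel
    have h5 : (r₁ - Lx) * A ≤ r₂ * ⟪y2 - y1, v - w⟫ := by
      rw [← e5]
      rw [e3] at e1
      rw [e4] at h2
      linarith
    have h6 := real_inner_le_norm (y2 - y1) (v - w)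
    have h7 := hdiam y2 m2 y1 m1
    rw [norm_sub_rev v w] at h6
    have h8 : ‖y2 - y1‖ * ‖w - v‖ ≤ δ * (δ + α * s) :=
      mul_le_mul h7 hwv (norm_nonneg _) hδ0
    exact h5.trans (mul_le_mul_of_nonneg_left (h6.trans h8) hr2.le)
  -- second bound
  have hB2 : (r₁ - Lx) * A ≤ r₂ * (((α + κ) * s) * (δ + α * s)) := by
    have h1 := hconcv v w
    have h2 := hconcv w v
    rw [hfix, sub_self, inner_zero_left] at h2
    have h3 := real_inner_le_norm (yzv z v - v) (w - v)
    have h4 : ‖yzv z v - v‖ * ‖w - v‖ ≤ ((α + κ) * s) * (δ + α * s) :=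
      mul_le_mul hyv hwv (norm_nonneg _) (by positivity)
    have h5 := mul_le_mul_of_nonneg_left (h3.trans h4) hr2.le
    linarith
  have hfinal : (r₁ - Lx) * A ≤ 4 * r₂ * δ * ((α + κ) * s) := by
    have hκ0 : 0 ≤ κ * s := by positivity
    have hαs : 0 ≤ α * s := by positivity
    have hle : α * s ≤ (α + κ) * s := by linarith
    set q := (α + κ) * s
    have hq : 0 ≤ q := hαs.trans hle
    have hpos : 0 ≤ r₂ * (δ * q) := by positivity
    rcases le_total q δ with hc | hc
    · have : q * (δ + α * s) ≤ q * (δ + δ) :=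
        mul_le_mul_of_nonneg_left (by linarith) hq
      have := mul_le_mul_of_nonneg_left this hr2.le
      linarith
    · have : δ * (δ + α * s) ≤ δ * (q + q) :=
        mul_le_mul_of_nonneg_left (by linarith) hδ0
      have := mul_le_mul_of_nonneg_left this hr2.le
      linarith
  have hfe : 4 * r₂ * δ / (r₁ - Lx) * (α + κ) * s = 4 * r₂ * δ * ((α + κ) * s) / (r₁ - Lx) := by
    ring
  rw [hfe, le_div_iff₀ hm]
  linarith
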